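/- Let k ≥ 1, let ν be a probability measure on M, let f ∈ H¹(ν) with ∫ f² dν = 1 and ∫ Γ(f) dν ≤ Λ for a real number Λ, and let p₁, …, p_{k−1} ∈ H¹(ν) and positive reals λ₁, …, λ_{k−1}, λ be such that: (a) ∫ p_i p_j dν = 0 for all i ≠ j; (b) for every i and every g ∈ H¹(ν), ∫ Γ(p_i, g) dν = λ_i ∫ p_i g dν; (c) ∫ (f − Σ_{j=1}^{k−1} p_j) p_i dν = 0 for every i; (d) λ ∫ (f − Σ_{i=1}^{k−1} p_i)² dν ≤ ∫ Γ(f − Σ_{i=1}^{k−1} p_i) dν. Then λ ≤ Λ + Σ_{i=1}^{k−1} (λ − λ_i) ∫ p_i² dν. -/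

import Mathlib

open MeasureTheory Real

/-- Membership in `H¹(ν)`: `C¹`, centered, with integrable carré du champ
`Γ(f)(x) = a(x) f'(x)²`. -/
def MemH1 (a : ℝ → ℝ) (ν : MeasureTheory.Measure ℝ) (f : ℝ → ℝ) : Prop :=
  ContDiff ℝ 1 f ∧ (∫ x, f x ∂ν) = 0 ∧
    MeasureTheory.Integrable (fun x => a x * (deriv f x) ^ 2) ν

/-- Weighted Cauchy–Schwarz integrability; the weight itself need not be measurable. -/
lemma integrable_weight_mul_mul {ν : Measure ℝ} {w u v : ℝ → ℝ} (hw : ∀ x, 0 ≤ w x)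
    (hu : Measurable u) (hv : Measurable v)
    (hwu : Integrable (fun x => w x * u x ^ 2) ν) (hwv : Integrable (fun x => w x * v x ^ 2) ν) :
    Integrable (fun x => w x * u x * v x) ν := by
  have hmeas : AEStronglyMeasurable (fun x => w x * u x * v x) ν := by
    have h : (fun x => w x * u x * v x) = fun x => w x * u x ^ 2 * (v x / u x) := by
      funext x
      rcases eq_or_ne (u x) 0 with h0 | h0
      · simp [h0]
      · field_simp
    rw [h]
    exact hwu.aestronglyMeasurable.mul (hv.div hu).aestronglyMeasurable
  refine (hwu.add hwv).mono' hmeas (Filter.Eventually.of_forall fun x => ?_)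
  have h1 := mul_nonneg (hw x) (sq_nonneg (u x + v x))
  have h2 := mul_nonneg (hw x) (sq_nonneg (u x - v x))
  have h3 := mul_nonneg (hw x) (sq_nonneg (u x))
  have h4 := mul_nonneg (hw x) (sq_nonneg (v x))
  rw [Real.norm_eq_abs, Pi.add_apply]
  exact abs_le.2 ⟨by nlinarith, by nlinarith⟩

lemma integrable_weight_sub_sq {ν : Measure ℝ} {w u v : ℝ → ℝ} (hw : ∀ x, 0 ≤ w x)
    (hu : Measurable u) (hv : Measurable v)
    (hwu : Integrable (fun x => w x * u x ^ 2) ν) (hwv : Integrable (fun x => w x * v x ^ 2) ν) :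
    Integrable (fun x => w x * (u x - v x) ^ 2) ν := by
  refine ((hwu.add hwv).sub ((integrable_weight_mul_mul hw hu hv hwu hwv).const_mul 2)).congr
    (Filter.Eventually.of_forall fun x => ?_)
  simp only [Pi.add_apply, Pi.sub_apply]
  ring

lemma integrable_weight_sum_sq {ν : Measure ℝ} {ι : Type*} [Fintype ι] {w : ℝ → ℝ}
    {q : ι → ℝ → ℝ} (hw : ∀ x, 0 ≤ w x) (hq : ∀ i, Measurable (q i))
    (hwq : ∀ i, Integrable (fun x => w x * q i x ^ 2) ν) :
    Integrable (fun x => w x * (∑ i, q i x) ^ 2) ν := by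
  have h : (fun x => w x * (∑ i, q i x) ^ 2) = fun x => ∑ i, ∑ j, w x * q i x * q j x := by
    funext x
    rw [sq, Finset.sum_mul_sum, Finset.mul_sum]
    refine Finset.sum_congr rfl fun i _ => ?_
    rw [Finset.mul_sum]
    exact Finset.sum_congr rfl fun j _ => by ring
  rw [h]
  exact integrable_finsetSum _ fun i _ => integrable_finsetSum _ fun j _ =>
    integrable_weight_mul_mul hw (hq i) (hq j) (hwq i) (hwq j)

/-- Pythagoras in a weighted `L²` space: `q i` mutually orthogonal and orthogonal to
`u - ∑ i, q i`. -/
lemma integral_weight_sq_eq_add_sum {ν : Measure ℝ} {ι : Type*} [Fintype ι] {w u : ℝ → ℝ}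
    {q : ι → ℝ → ℝ} (hw : ∀ x, 0 ≤ w x) (hu : Measurable u) (hq : ∀ i, Measurable (q i))
    (hwu : Integrable (fun x => w x * u x ^ 2) ν)
    (hwq : ∀ i, Integrable (fun x => w x * q i x ^ 2) ν)
    (horth : ∀ i j, i ≠ j → ∫ x, w x * q i x * q j x ∂ν = 0)
    (hperp : ∀ i, ∫ x, w x * q i x * (u x - ∑ j, q j x) ∂ν = 0) :
    ∫ x, w x * u x ^ 2 ∂ν =
      ∫ x, w x * (u x - ∑ j, q j x) ^ 2 ∂ν + ∑ i, ∫ x, w x * q i x ^ 2 ∂ν := by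
  classical
  have hsum : Measurable fun x => ∑ j, q j x := Finset.measurable_fun_sum _ fun i _ => hq i
  have hh := integrable_weight_sub_sq hw hu hsum hwu (integrable_weight_sum_sq hw hq hwq)
  have hqh := fun i => integrable_weight_mul_mul hw (hq i) (hu.sub hsum) (hwq i) hh
  have hqq := fun i j => integrable_weight_mul_mul hw (hq i) (hq j) (hwq i) (hwq j)
  have hexp : (fun x => w x * u x ^ 2) = fun x =>
      w x * (u x - ∑ j, q j x) ^ 2 + ∑ i, (2 * (w x * q i x * (u x - ∑ j, q j x)) +
        ∑ j, w x * q i x * q j x) := by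
    funext x
    rw [Finset.sum_add_distrib]
    simp only [← Finset.mul_sum, ← Finset.sum_mul]
    ring
  have hdiag : ∀ i, ∑ j, ∫ x, w x * q i x * q j x ∂ν = ∫ x, w x * q i x ^ 2 ∂ν := fun i => by
    rw [Finset.sum_eq_single i (fun j _ hj => horth i j hj.symm) (by simp)]
    exact integral_congr_ae (Filter.Eventually.of_forall fun x => by ring)
  have hqqs := fun i => integrable_finsetSum Finset.univ fun j _ => hqq i j
  have hterm := fun i => ((hqh i).const_mul 2).add (hqqs i)
  rw [hexp]
  refine (integral_add hh (integrable_finsetSum _ fun i _ => hterm i)).trans ?_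
  congr 1
  refine (integral_finsetSum _ fun i _ => hterm i).trans (Finset.sum_congr rfl fun i _ => ?_)
  refine (integral_add ((hqh i).const_mul 2) (hqqs i)).trans ?_
  rw [integral_const_mul, show ∫ x, w x * q i x * (u - fun x => ∑ j, q j x) x ∂ν = 0 from hperp i,
    integral_finsetSum _ fun j _ => hqq i j, hdiag i]
  ring

/-- The truncation `(p - m) / (1 + p²)` of `p`, centered by `m`, belongs to `H¹(ν)`. -/
lemma MemH1.truncation {a : ℝ → ℝ} {ν : Measure ℝ} {p : ℝ → ℝ}
    (hp : MemH1 a ν p) {m : ℝ} (hm : ∫ x, (p x - m) / (1 + p x ^ 2) ∂ν = 0) :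
    MemH1 a ν (fun x => (p x - m) / (1 + p x ^ 2)) := by
  have hpos : ∀ t : ℝ, 0 < 1 + t ^ 2 := fun t => by positivity
  refine ⟨(hp.1.sub contDiff_const).div (contDiff_const.add (hp.1.pow 2))
    fun x => (hpos _).ne', hm, ?_⟩
  set c : ℝ → ℝ := fun x => (1 * (1 + p x ^ 2) - (p x - m) * (2 * p x)) / (1 + p x ^ 2) ^ 2
    with hc
  have hderiv : ∀ x, deriv (fun x => (p x - m) / (1 + p x ^ 2)) x = c x * deriv p x := by
    intro x
    have hd := (hp.1.differentiable one_ne_zero x).hasDerivAt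
    have h := (hd.sub_const m).fun_div ((hd.fun_pow 2).const_add 1) (hpos (p x)).ne'
    rw [h.deriv, hc]
    simp only [Nat.cast_ofNat]
    ring
  have hcont : Continuous p := hp.1.continuous
  have hcm : Continuous c := by
    rw [hc]
    exact Continuous.div (by fun_prop) (by fun_prop) fun x => (pow_pos (hpos _) 2).ne'
  have hbound : ∀ x, ‖c x ^ 2‖ ≤ (3 + |m|) ^ 2 := by
    intro x
    rw [norm_pow, Real.norm_eq_abs]
    refine pow_le_pow_left₀ (abs_nonneg _) ?_ 2
    rw [hc]
    simp only
    rw [abs_div, abs_of_pos (pow_pos (hpos (p x)) 2), div_le_iff₀ (pow_pos (hpos (p x)) 2)]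
    have h0 : |m * (2 * p x)| ≤ |m| * (1 + p x ^ 2) := by
      rw [abs_mul]
      refine mul_le_mul_of_nonneg_left ?_ (abs_nonneg m)
      exact abs_le.2 ⟨by nlinarith [sq_nonneg (p x + 1)], by nlinarith [sq_nonneg (p x - 1)]⟩
    have h1 := abs_le.1 h0
    have h2 : 0 ≤ |m| * p x ^ 2 := by positivity
    have h3 : 0 ≤ |m| * p x ^ 4 := by positivity
    have h4 : 0 ≤ p x ^ 4 := by positivity
    have h5 := sq_nonneg (p x)
    refine abs_le.2 ⟨?_, ?_⟩ <;> nlinarith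
  refine (hp.2.2.bdd_mul (c := (3 + |m|) ^ 2) (hcm.pow 2).aestronglyMeasurable
    (Filter.Eventually.of_forall hbound)).congr (Filter.Eventually.of_forall fun x => ?_)
  simp only [hderiv, Pi.pow_apply]
  ring

/-- A weak eigenfunction is square integrable: if not, its energy would vanish and testing against
its truncation would show it to be almost everywhere constant. -/
lemma MemH1.integrable_sq_of_eigen {a : ℝ → ℝ} {ν : Measure ℝ} [IsProbabilityMeasure ν]
    {p : ℝ → ℝ} (ha : ∀ x, 0 ≤ a x) (hp : MemH1 a ν p) {l : ℝ} (hl : 0 < l)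
    (heig : ∀ g, MemH1 a ν g →
      ∫ x, a x * deriv p x * deriv g x ∂ν = l * ∫ x, p x * g x ∂ν) :
    Integrable (fun x => p x ^ 2) ν := by
  by_contra hnot
  have hcont : Continuous p := hp.1.continuous
  have hpos : ∀ t : ℝ, 0 < 1 + t ^ 2 := fun t => by positivity
  have henergy : ∫ x, a x * deriv p x ^ 2 ∂ν = 0 := by
    have h := heig p hp
    simp only [← sq, mul_assoc] at h
    rw [h, integral_undef hnot, mul_zero]
  have hae : ∀ᵐ x ∂ν, a x * deriv p x ^ 2 = 0 :=
    (integral_eq_zero_iff_of_nonneg (fun x => mul_nonneg (ha x) (sq_nonneg _)) hp.2.2).1 henergy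
  have hint : ∀ φ : ℝ → ℝ, Continuous φ → ∀ C, (∀ t, |φ t| ≤ C) →
      Integrable (fun x => φ (p x)) ν := fun φ hφ C hC =>
    Integrable.of_bound (hφ.comp hcont).aestronglyMeasurable C
      (Filter.Eventually.of_forall fun x => hC _)
  have hbd : ∀ n t : ℝ, |n| ≤ 1 + t ^ 2 → |n / (1 + t ^ 2)| ≤ 1 := fun n t h => by
    rw [abs_div, abs_of_pos (hpos t)]
    exact div_le_one_of_le₀ h (hpos t).le
  have i0 : Integrable (fun x => 1 / (1 + p x ^ 2)) ν :=
    hint (fun t => 1 / (1 + t ^ 2))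
      (continuous_const.div (by fun_prop) fun t => (hpos t).ne') 1
      fun t => hbd _ _ (by rw [abs_one]; nlinarith [sq_nonneg t])
  have i1 : Integrable (fun x => p x / (1 + p x ^ 2)) ν :=
    hint (fun t => t / (1 + t ^ 2))
      (continuous_id.div (by fun_prop) fun t => (hpos t).ne') 1
      fun t => hbd _ _ (abs_le.2 ⟨by nlinarith [sq_nonneg (t + 1)],
        by nlinarith [sq_nonneg (t - 1)]⟩)
  have i2 : Integrable (fun x => p x ^ 2 / (1 + p x ^ 2)) ν :=
    hint (fun t => t ^ 2 / (1 + t ^ 2))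
      ((continuous_pow 2).div (by fun_prop) fun t => (hpos t).ne') 1
      fun t => hbd _ _ (by rw [abs_of_nonneg (sq_nonneg t)]; linarith)
  have hz : 0 < ∫ x, 1 / (1 + p x ^ 2) ∂ν := by
    rw [integral_pos_iff_support_of_nonneg (fun x => (div_pos one_pos (hpos _)).le) i0]
    have : Function.support (fun x => 1 / (1 + p x ^ 2)) = Set.univ :=
      Set.eq_univ_of_forall fun x => (div_pos one_pos (hpos _)).ne'
    rw [this, measure_univ]
    exact one_pos
  obtain ⟨m, hm⟩ : ∃ m, ∫ x, p x / (1 + p x ^ 2) ∂ν = m * ∫ x, 1 / (1 + p x ^ 2) ∂ν :=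
    ⟨_, (div_mul_cancel₀ _ hz.ne').symm⟩
  have hcenter : ∫ x, (p x - m) / (1 + p x ^ 2) ∂ν = 0 := by
    have h : (fun x => (p x - m) / (1 + p x ^ 2)) =
        fun x => p x / (1 + p x ^ 2) - m * (1 / (1 + p x ^ 2)) := by
      funext x; ring
    rw [h, integral_sub i1 (i0.const_mul m), integral_const_mul, hm, sub_self]
  have htest := heig _ (hp.truncation hcenter)
  have hleft : ∫ x, a x * deriv p x * deriv (fun x => (p x - m) / (1 + p x ^ 2)) x ∂ν = 0 := by
    refine integral_eq_zero_of_ae (hae.mono fun x hx => ?_)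
    rcases mul_eq_zero.1 hx with h | h
    · simp [h]
    · simp [pow_eq_zero_iff two_ne_zero |>.1 h]
  rw [hleft] at htest
  have hright : ∫ x, p x * ((p x - m) / (1 + p x ^ 2)) ∂ν = 0 := by
    rcases mul_eq_zero.1 htest.symm with h | h
    · exact absurd h hl.ne'
    · exact h
  have ipg : Integrable (fun x => p x * ((p x - m) / (1 + p x ^ 2))) ν :=
    (i2.sub (i1.const_mul m)).congr (Filter.Eventually.of_forall fun x => by
      simp only [Pi.sub_apply]; ring)
  have ig : Integrable (fun x => (p x - m) / (1 + p x ^ 2)) ν :=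
    (i1.sub (i0.const_mul m)).congr (Filter.Eventually.of_forall fun x => by
      simp only [Pi.sub_apply]; ring)
  have hsq : (fun x => (p x - m) ^ 2 / (1 + p x ^ 2)) = fun x =>
      p x * ((p x - m) / (1 + p x ^ 2)) - m * ((p x - m) / (1 + p x ^ 2)) := by
    funext x; ring
  have isq : Integrable (fun x => (p x - m) ^ 2 / (1 + p x ^ 2)) ν := by
    rw [hsq]; exact ipg.sub (ig.const_mul m)
  have hvar : ∫ x, (p x - m) ^ 2 / (1 + p x ^ 2) ∂ν = 0 := by
    rw [hsq, integral_sub ipg (ig.const_mul m), integral_const_mul, hright, hcenter]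
    simp
  have hconst := (integral_eq_zero_iff_of_nonneg
    (fun x => div_nonneg (sq_nonneg (p x - m)) (hpos (p x)).le) isq).1 hvar
  refine hnot ((integrable_const (m ^ 2)).congr (hconst.mono fun x hx => ?_))
  have h : (p x - m) ^ 2 = 0 := (div_eq_zero_iff.1 hx).resolve_right (hpos _).ne'
  have hxm : p x = m := sub_eq_zero.1 (pow_eq_zero_iff two_ne_zero |>.1 h)
  simp only [hxm]

/-- Eigenvalue comparison lemma (Lemma 2.1). -/
theorem eigenvalue_comparison
    (ν : Measure ℝ) [IsProbabilityMeasure ν]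
    (a : ℝ → ℝ) (ha : ∀ x, 0 ≤ a x)
    (k : ℕ) (hk : 1 ≤ k)
    (f : ℝ → ℝ) (hf : MemH1 a ν f)
    (Λ : ℝ) (hf2 : ∫ x, (f x) ^ 2 ∂ν = 1)
    (hfΓ : ∫ x, a x * (deriv f x) ^ 2 ∂ν ≤ Λ)
    (p : Fin (k - 1) → ℝ → ℝ) (hp : ∀ i, MemH1 a ν (p i))
    (lams : Fin (k - 1) → ℝ) (hlams : ∀ i, 0 < lams i)
    (lam : ℝ) (hlam : 0 < lam)
    (horth : ∀ i j, i ≠ j → ∫ x, p i x * p j x ∂ν = 0)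
    (heig : ∀ i, ∀ g, MemH1 a ν g →
      ∫ x, a x * deriv (p i) x * deriv g x ∂ν = lams i * ∫ x, p i x * g x ∂ν)
    (hperp : ∀ i, ∫ x, (f x - ∑ j, p j x) * p i x ∂ν = 0)
    (hpoinc : lam * ∫ x, (f x - ∑ i, p i x) ^ 2 ∂ν ≤
      ∫ x, a x * (deriv (fun y => f y - ∑ i, p i y) x) ^ 2 ∂ν) :
    lam ≤ Λ + ∑ i, (lam - lams i) * ∫ x, (p i x) ^ 2 ∂ν := by
  have hpc : ∀ i, Continuous (p i) := fun i => (hp i).1.continuous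
  have hfm : Measurable f := hf.1.continuous.measurable
  have hfd : Differentiable ℝ f := hf.1.differentiable one_ne_zero
  have hpd : ∀ i, Differentiable ℝ (p i) := fun i => (hp i).1.differentiable one_ne_zero
  have hfsq : Integrable (fun x => f x ^ 2) ν := by
    by_contra h
    rw [integral_undef h] at hf2
    exact zero_ne_one hf2
  have hpsq : ∀ i, Integrable (fun x => p i x ^ 2) ν := fun i =>
    (hp i).integrable_sq_of_eigen ha (hlams i) (heig i)
  have hdsub : ∀ x, deriv (fun y => f y - ∑ i, p i y) x = deriv f x - ∑ i, deriv (p i) x := by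
    intro x
    rw [deriv_fun_sub (hfd x) (DifferentiableAt.fun_sum fun i _ => hpd i x),
      deriv_fun_sum fun i _ => hpd i x]
  have hL1 : ∀ g : ℝ → ℝ, Continuous g → Integrable (fun x => g x ^ 2) ν → Integrable g ν :=
    fun g hg h => ((memLp_two_iff_integrable_sq hg.aestronglyMeasurable).2 h).integrable
      one_le_two
  have hmem : MemH1 a ν (fun y => f y - ∑ i, p i y) := by
    refine ⟨hf.1.sub (ContDiff.sum fun i _ => (hp i).1), ?_, ?_⟩
    · have hpi := fun i => hL1 _ (hpc i) (hpsq i)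
      rw [integral_sub (hL1 _ hf.1.continuous hfsq) (integrable_finsetSum _ fun i _ => hpi i),
        integral_finsetSum _ fun i _ => hpi i, hf.2.1,
        Finset.sum_eq_zero fun i _ => (hp i).2.1, sub_zero]
    · simp only [hdsub]
      exact integrable_weight_sub_sq ha (measurable_deriv f)
        (Finset.measurable_fun_sum _ fun i _ => measurable_deriv (p i)) hf.2.2
        (integrable_weight_sum_sq ha (fun i => measurable_deriv (p i)) fun i => (hp i).2.2)
  have hmass := integral_weight_sq_eq_add_sum (ν := ν) (w := fun _ => 1) (u := f) (q := p)
    (fun _ => zero_le_one) hfm (fun i => (hpc i).measurable) (by simpa using hfsq)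
    (fun i => by simpa using hpsq i) (fun i j hij => by simpa using horth i j hij)
    (fun i => by simpa [mul_comm] using hperp i)
  simp only [one_mul] at hmass
  have henergy := integral_weight_sq_eq_add_sum (ν := ν) (w := a) (u := deriv f)
    (q := fun i => deriv (p i)) ha (measurable_deriv f) (fun i => measurable_deriv (p i))
    hf.2.2 (fun i => (hp i).2.2)
    (fun i j hij => by rw [heig i _ (hp j), horth i j hij, mul_zero])
    (fun i => by
      have h := heig i _ hmem
      simp only [hdsub] at h
      rw [h]
      simp only [mul_comm (p i _)]
      rw [hperp i, mul_zero])
  have hself : ∀ i, ∫ x, a x * deriv (p i) x ^ 2 ∂ν = lams i * ∫ x, p i x ^ 2 ∂ν := fun i => by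
    have h := heig i _ (hp i)
    simpa only [mul_assoc, ← sq] using h
  simp only [hself] at henergy
  simp only [hdsub] at hpoinc
  simp only [sub_mul, Finset.sum_sub_distrib, ← Finset.mul_sum]
  rw [hf2] at hmass
  have h : lam = lam * ∫ x, (f x - ∑ i, p i x) ^ 2 ∂ν + lam * ∑ i, ∫ x, p i x ^ 2 ∂ν := by
    rw [← mul_add, ← hmass, mul_one]
  linarith
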